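/- Let G be a group containing a subgroup H isomorphic to F₂ × K, where F₂ is the free group of rank 2 and K is a finite group, such that the extension H ≤ G is almost-CEP. Then G is CEP-equipped; in particular, G contains a subgroup M isomorphic to the free group of rank 2 such that the extension M ≤ G satisfies CEP. -/

import Mathlib

/-- A subgroup `H ≤ G` satisfies the *Congruence Extension Property* (CEP) if for
every subset `R ⊆ H`, the normal closure of `R` in `H` equals `H ∩ ⟪R⟫_G`
(expressed as the pullback of the normal closure of `R` in `G` along `H ↪ G`). -/
def IsCEP {G : Type*} [Group G] (H : Subgroup G) : Prop :=
  ∀ R : Set H, Subgroup.normalClosure R =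
    (Subgroup.normalClosure (Subtype.val '' R)).comap H.subtype

/-- A subgroup `H ≤ G` is *almost-CEP* if there is a finite subset
`S ⊆ H ∖ {1}` such that for every `R ⊆ H` whose normal closure in `H` is disjoint
from `S`, the normal closure of `R` in `H` equals `H ∩ ⟪R⟫_G`. -/
def AlmostCEP {G : Type*} [Group G] (H : Subgroup G) : Prop :=
  ∃ S : Set H, S.Finite ∧ (1 : H) ∉ S ∧
    ∀ R : Set H, (Subgroup.normalClosure R : Set H) ∩ S = ∅ →
      Subgroup.normalClosure R =
        (Subgroup.normalClosure (Subtype.val '' R)).comap H.subtype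

/-- Free groups are residually finite: the word `s` acts nontrivially on `1` when every generator
acts by a permutation of the finite set of suffixes of `s` extending left multiplication. -/
instance FreeGroup.residuallyFinite {α : Type*} : Group.ResiduallyFinite (FreeGroup α) := by
  classical
  rw [Group.residuallyFinite_iff_exists_finiteIndex]
  intro s hs
  let B : Set (FreeGroup α) := {g | ∃ L, L <:+ s.toWord ∧ FreeGroup.mk L = g}
  have hB : B.Finite := by
    have h : {L | L <:+ s.toWord}.Finite := by
      refine (s.toWord.tails.toFinset.finite_toSet).subset fun L hL => ?_
      simpa using hL
    exact (h.image FreeGroup.mk).subset fun g ⟨L, hL, hg⟩ => ⟨L, hL, hg⟩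
  have : Finite B := hB
  have hperm : ∀ x : α, ∃ σ : Equiv.Perm B, ∀ g h : B,
      FreeGroup.of x * (g : FreeGroup α) = h → σ g = h := by
    intro x
    obtain ⟨σ, hσ⟩ := Equiv.Perm.exists_extending_pair
      (α := {g : B // FreeGroup.of x * (g : FreeGroup α) ∈ B})
      (fun g => g.1) (fun g => (⟨_, g.2⟩ : B)) Subtype.val_injective
      (fun g h hgh => by
        simp only [Subtype.mk.injEq, mul_right_inj] at hgh
        exact Subtype.ext (Subtype.ext hgh))
    refine ⟨σ, fun g h hgh => ?_⟩
    have := hσ ⟨g, hgh ▸ h.2⟩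
    simp only at this
    rw [this]
    exact Subtype.ext hgh
  choose σ hσ using hperm
  have hsuf : ∀ L (hL : L <:+ s.toWord),
      FreeGroup.lift σ (FreeGroup.mk L) ⟨1, [], List.nil_suffix, rfl⟩ =
        ⟨FreeGroup.mk L, L, hL, rfl⟩ := by
    intro L
    induction L with
    | nil => intro hL; rfl
    | cons p L ih =>
      intro hL
      have hL' := (List.suffix_cons p L).trans hL
      have hmul : FreeGroup.mk (p :: L) = FreeGroup.mk [p] * FreeGroup.mk L := rfl
      have key : FreeGroup.lift σ (FreeGroup.mk (p :: L)) ⟨1, [], List.nil_suffix, rfl⟩ =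
          FreeGroup.lift σ (FreeGroup.mk [p]) ⟨FreeGroup.mk L, L, hL', rfl⟩ := by
        rw [hmul, _root_.map_mul, Equiv.Perm.mul_apply, ih hL']
      rw [key]
      obtain ⟨x, _ | _⟩ := p
      · have : FreeGroup.mk [(x, false)] = (FreeGroup.of x)⁻¹ := rfl
        rw [this, _root_.map_inv, FreeGroup.lift_apply_of, Equiv.Perm.inv_eq_iff_eq]
        refine (hσ x _ _ ?_).symm
        simp [hmul, this]
      · exact hσ x _ _ rfl
  refine ⟨(FreeGroup.lift σ).ker, inferInstance, fun hker => hs ?_⟩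
  have h := hsuf s.toWord (List.suffix_refl _)
  have h1 : FreeGroup.lift σ (FreeGroup.mk s.toWord) = 1 := by
    rw [FreeGroup.mk_toWord, (FreeGroup.lift σ).mem_ker.mp hker]
  rw [h1] at h
  exact FreeGroup.mk_toWord.symm.trans (congrArg Subtype.val h).symm

/-- A group embedding in a residually finite group is residually finite. -/
theorem Group.ResiduallyFinite.of_injective {G G' : Type*} [Group G] [Group G']
    [Group.ResiduallyFinite G'] (f : G →* G') (hf : Function.Injective f) :
    Group.ResiduallyFinite G := by
  rw [Group.residuallyFinite_iff_exists_finiteIndex]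
  intro g hg
  obtain ⟨U, hU⟩ := Group.exists_finiteIndexNormalSubgroup_notMem (f g)
    ((map_ne_one_iff f hf).mpr hg)
  exact ⟨(U.comap f).toSubgroup, inferInstance, hU⟩

/-- In a residually finite group, a finite set of nontrivial elements is avoided by some normal
subgroup of finite index. -/
theorem Group.ResiduallyFinite.exists_normal_finiteIndex_disjoint {G : Type*} [Group G]
    [Group.ResiduallyFinite G] {S : Set G} (hS : S.Finite) (h1 : (1 : G) ∉ S) :
    ∃ V : Subgroup G, V.Normal ∧ V.FiniteIndex ∧ ∀ g ∈ S, g ∉ V := by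
  induction S, hS using Set.Finite.induction_on with
  | empty => exact ⟨⊤, inferInstance, inferInstance, by simp⟩
  | @insert s S _ _ ih =>
    simp only [Set.mem_insert_iff, not_or] at h1
    obtain ⟨V, hV, hVf, hVS⟩ := ih h1.2
    obtain ⟨U, hU⟩ := Group.exists_finiteIndexNormalSubgroup_notMem s (Ne.symm h1.1)
    refine ⟨U.toSubgroup ⊓ V, inferInstance, inferInstance, ?_⟩
    rintro g (rfl | hg) hgV
    · exact hU hgV.1
    · exact hVS g hg hgV.2

namespace RegularWreathProduct

/-- The inclusion of the base group in the regular wreath product. -/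
def ofBase (D Q : Type*) [Group D] [Group Q] : (Q → D) →* D ≀ᵣ Q where
  toFun f := ⟨f, 1⟩
  map_one' := rfl
  map_mul' f g := by ext <;> simp

variable {D Q : Type*} [Group D] [Group Q]

theorem ofBase_injective : Function.Injective (ofBase D Q) := fun _ _ h =>
  congrArg RegularWreathProduct.left h

theorem inl_mul_ofBase_mul_inl_inv (c : Q) (f : Q → D) :
    inl c * ofBase D Q f * (inl c)⁻¹ = ofBase D Q fun x => f (c⁻¹ * x) := by
  ext <;> simp [ofBase]

end RegularWreathProduct

open RegularWreathProduct
open scoped commutatorElement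

/-- Every group embeds in a group where each of its elements has an `e`-th root. -/
theorem exists_embedding_root (Q : Type*) [Group Q] (e : ℕ) [NeZero e] :
    ∃ j : Q →* Q ≀ᵣ Multiplicative (ZMod e), Function.Injective j ∧
      ∀ q, ∃ r, r ^ e = j q := by
  refine ⟨(ofBase _ _).comp (Pi.constMonoidHom _ Q), ofBase_injective.comp
    Function.const_injective, fun q => ?_⟩
  let r : Q ≀ᵣ Multiplicative (ZMod e) :=
    ⟨fun x => if x.toAdd = 0 then q else 1, .ofAdd 1⟩
  have hr : ∀ m : ℕ, m ≤ e → r ^ m =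
      ⟨fun x => if x.toAdd.val < m then q else 1, .ofAdd (m : ZMod e)⟩ := by
    intro m
    induction m with
    | zero => intro _; ext <;> simp
    | succ m ih =>
      intro hm
      rw [pow_succ, ih (by omega)]
      ext x
      · have hx : -(m : ZMod e) + x.toAdd = 0 ↔ x.toAdd.val = m := by
          rw [neg_add_eq_zero]
          constructor
          · intro h
            rw [← h, ZMod.val_natCast_of_lt (by omega)]
          · intro h
            rw [← h, ZMod.natCast_zmod_val]
        simp only [r, mul_left, Pi.mul_apply, toAdd_mul, toAdd_inv, toAdd_ofAdd, hx]
        split_ifs <;> first | omega | simp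
      · simp [r]
  refine ⟨r, ?_⟩
  rw [hr e le_rfl]
  ext x
  · simp [ofBase, ZMod.val_lt]
  · simp [ofBase]

/-- Every group embeds in a group where its elements become commutators with a common entry. -/
theorem exists_embedding_commutator (Q : Type*) [Group Q] :
    ∃ (j : Q →* Q ≀ᵣ Multiplicative ℤ) (t : Q ≀ᵣ Multiplicative ℤ), Function.Injective j ∧
      ∀ q, ∃ g, ⁅t, g⁆ = j q := by
  refine ⟨(ofBase _ _).comp (Pi.constMonoidHom _ Q), inl (Multiplicative.ofAdd 1), ofBase_injective.comp
    Function.const_injective, fun q => ⟨ofBase _ _ fun x => q ^ (-x.toAdd), ?_⟩⟩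
  rw [commutatorElement_def, inl_mul_ofBase_mul_inl_inv, ← map_inv (ofBase Q (Multiplicative ℤ)),
    ← map_mul (ofBase Q (Multiplicative ℤ))]
  refine congrArg (ofBase _ _) (funext fun x => ?_)
  simp [← zpow_add]

/-- Given `t` and `g i` in a group `P`, there are two elements `a`, `b` of a larger group such
that all commutators `⁅t, g i⁆` are given by fixed words in `a` and `b`. -/
theorem exists_embedding_commutator_words (P : Type*) [Group P] {n : ℕ} (t : P)
    (g : Fin n → P) :
    ∃ (j : P →* P ≀ᵣ Multiplicative ℤ) (a b : P ≀ᵣ Multiplicative ℤ), Function.Injective j ∧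
      ∀ i : Fin n, ⁅a, (b ^ (2 * (i : ℕ) + 1))⁻¹ * a * b ^ (2 * (i : ℕ) + 1)⁆ = j ⁅t, g i⁆ := by
  classical
  let f : Multiplicative ℤ → P := fun x =>
    if x.toAdd = 0 then t else
      if h : ∃ i : Fin n, x.toAdd = 2 * (i : ℕ) + 1 then g h.choose else 1
  have f_odd (x : Multiplicative ℤ) (i : Fin n) (hx : x.toAdd = 2 * (i : ℕ) + 1) :
      f x = g i := by
    have h : ∃ i : Fin n, x.toAdd = 2 * (i : ℕ) + 1 := ⟨i, hx⟩
    have hi : h.choose = i := by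
      have := h.choose_spec
      ext
      omega
    simp only [f]
    rw [if_neg (by omega), dif_pos h, hi]
  have f_one (x : Multiplicative ℤ) (h0 : x.toAdd ≠ 0)
      (hx : ¬ ∃ i : Fin n, x.toAdd = 2 * (i : ℕ) + 1) : f x = 1 := by
    simp only [f]
    rw [if_neg h0, dif_neg hx]
  refine ⟨(ofBase _ _).comp (MonoidHom.mulSingle (fun _ : Multiplicative ℤ => P) 1),
    ofBase _ _ f, inl (.ofAdd 1),
    ofBase_injective.comp (Pi.mulSingle_injective (M := fun _ : Multiplicative ℤ => P) 1), fun i => ?_⟩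
  have hconj := inl_mul_ofBase_mul_inl_inv ((Multiplicative.ofAdd (1 : ℤ)) ^ (2 * (i : ℕ) + 1))⁻¹ f
  rw [map_inv, inv_inv, map_pow] at hconj
  rw [hconj, ← map_commutatorElement]
  refine congrArg (ofBase P (Multiplicative ℤ)) (funext fun x => ?_)
  change ⁅f x, f _⁆ = _
  by_cases hx : x = 1
  · subst hx
    rw [f_odd (_ * 1) i (by simp)]
    simp [f, -map_commutatorElement]
  · have hx0 : x.toAdd ≠ 0 := fun h => hx h
    rw [MonoidHom.mulSingle_apply, Pi.mulSingle_eq_of_ne hx]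
    by_cases hodd : ∃ k : Fin n, x.toAdd = 2 * (k : ℕ) + 1
    · obtain ⟨k, hk⟩ := hodd
      rw [f_one (_ * x), commutatorElement_one_right]
      · simp; omega
      · rintro ⟨l, hl⟩
        simp at hl
        omega
    · rw [f_one x hx0 hodd, commutatorElement_one_left]

/-- The words generating free subgroups with the congruence extension property. -/
def cepWord {G : Type*} [Group G] (e : ℕ) (a b : G) (k : ℕ) : G :=
  ⁅a, (b ^ (2 * k + 1))⁻¹ * a * b ^ (2 * k + 1)⁆ ^ e

theorem map_cepWord {G L : Type*} [Group G] [Group L] (φ : G →* L) (e : ℕ) (a b : G) (k : ℕ) :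
    φ (cepWord e a b k) = cepWord e (φ a) (φ b) k := by
  simp [cepWord, map_commutatorElement]

/-- Any system of equations `cepWord e a b i = q i` over a group has a solution in a larger
group. -/
theorem exists_embedding_cepWord.{u} {Q : Type u} [Group Q] {n : ℕ} (e : ℕ) [NeZero e]
    (q : Fin n → Q) :
    ∃ (L : Type u) (_ : Group L) (j : Q →* L) (a b : L), Function.Injective j ∧
      ∀ i : Fin n, cepWord e a b i = j (q i) := by
  obtain ⟨j₁, hj₁, hroot⟩ := exists_embedding_root Q e
  choose r hr using fun i => hroot (q i)
  obtain ⟨j₂, t, hj₂, hcomm⟩ := exists_embedding_commutator (Q ≀ᵣ Multiplicative (ZMod e))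
  choose g hg using fun i => hcomm (r i)
  obtain ⟨j₃, a, b, hj₃, hab⟩ := exists_embedding_commutator_words _ t g
  refine ⟨_, inferInstance, (j₃.comp j₂).comp j₁, a, b, (hj₃.comp hj₂).comp hj₁, fun i => ?_⟩
  simp [cepWord, hab, hg, ← hr]

/-- The homomorphism from the free group of rank `n` to the free group of rank `2` sending the
`i`-th generator to the `i`-th word `cepWord`. -/
def cepHom (e n : ℕ) : FreeGroup (Fin n) →* FreeGroup (Fin 2) :=
  FreeGroup.lift fun i => cepWord e (.of 0) (.of 1) i

/-- Every normal subgroup of the free group of rank `n` is the kernel of the restriction along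
`cepHom` of a homomorphism out of the free group of rank `2`. -/
theorem exists_ker_comp_cepHom_eq (e n : ℕ) [NeZero e] (N : Subgroup (FreeGroup (Fin n)))
    [N.Normal] :
    ∃ (L : Type) (_ : Group L) (ψ : FreeGroup (Fin 2) →* L), (ψ.comp (cepHom e n)).ker = N := by
  obtain ⟨L, _, j, a, b, hj, hab⟩ :=
    exists_embedding_cepWord e fun i => QuotientGroup.mk' N (.of i)
  refine ⟨L, inferInstance, FreeGroup.lift ![a, b], ?_⟩
  have h : (FreeGroup.lift ![a, b]).comp (cepHom e n) = j.comp (QuotientGroup.mk' N) := by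
    ext i
    simp [cepHom, map_cepWord, hab]
  rw [h, MonoidHom.ker_comp_of_injective _ _ hj, QuotientGroup.ker_mk']

/-- Let `H ≤ G` be almost-CEP with exceptional set `S` avoided by a normal subgroup `V` of `H`. If
`ι : F →* H` takes values in `V` and every normal subgroup of `F` is the kernel of the restriction
along `ι` of a homomorphism out of `H`, then the image of `ι` is a CEP subgroup of `G`. -/
theorem isCEP_range_subtype_comp {G F : Type*} [Group G] [Group F] {H : Subgroup G} {S : Set H}
    (hS : ∀ R : Set H, (Subgroup.normalClosure R : Set H) ∩ S = ∅ →
      Subgroup.normalClosure R =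
        (Subgroup.normalClosure (Subtype.val '' R)).comap H.subtype)
    (V : Subgroup H) [V.Normal] (hVS : ∀ g ∈ S, g ∉ V) (ι : F →* H) (hι : ι.range ≤ V)
    (hker : ∀ N : Subgroup F, N.Normal →
      ∃ (L : Type) (_ : Group L) (ψ : H →* L), (ψ.comp ι).ker = N) :
    IsCEP (H.subtype.comp ι).range := by
  intro R
  apply le_antisymm
  · refine Subgroup.normalClosure_le_normal fun r hr => ?_
    exact Subgroup.subset_normalClosure ⟨r, hr, rfl⟩
  · rintro ⟨_, y, rfl⟩ hx
    set R' : Set H := {h | ∃ r ∈ R, (r : G) = h}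
    have himage : Subtype.val '' R' = Subtype.val '' R := by
      ext g
      constructor
      · rintro ⟨h, ⟨r, hr, hrh⟩, rfl⟩
        exact ⟨r, hr, hrh⟩
      · rintro ⟨r, hr, rfl⟩
        obtain ⟨z, hz⟩ := r.2
        exact ⟨ι z, ⟨r, hr, hz.symm⟩, hz⟩
    have hR'V : Subgroup.normalClosure R' ≤ V := by
      refine Subgroup.normalClosure_le_normal ?_
      rintro h ⟨r, -, hrh⟩
      obtain ⟨z, hz⟩ := r.2
      exact hι ⟨z, Subtype.ext (hz.trans hrh)⟩
    have hmem : ι y ∈ Subgroup.normalClosure R' := by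
      rw [hS R' (Set.eq_empty_iff_forall_notMem.mpr fun g hg => hVS g hg.2 (hR'V hg.1)), himage]
      exact hx
    obtain ⟨L, _, ψ, hψ⟩ := hker
      ((Subgroup.normalClosure R).comap (H.subtype.comp ι).rangeRestrict) inferInstance
    have hle : Subgroup.normalClosure R' ≤ ψ.ker := by
      refine Subgroup.normalClosure_le_normal ?_
      rintro h ⟨r, hr, hrh⟩
      obtain ⟨z, hz⟩ := r.2
      obtain rfl : ι z = h := Subtype.ext (hz.trans hrh)
      have : z ∈ (ψ.comp ι).ker := by
        rw [hψ]
        have hzr : (H.subtype.comp ι).rangeRestrict z = r := Subtype.ext hz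
        rw [Subgroup.mem_comap, hzr]
        exact Subgroup.subset_normalClosure hr
      exact this
    have hy : y ∈ (ψ.comp ι).ker := hle hmem
    rw [hψ] at hy
    exact hy

/-- If `G` contains an almost-CEP subgroup isomorphic to `F₂ × K` with `K` finite,
then `G` is CEP-equipped: for every finite `n ≥ 2` (in particular for `n = 2`),
`G` contains a CEP subgroup isomorphic to the free group of rank `n`. -/
theorem stmt_16 {G K : Type*} [Group G] [Group K] [Finite K] (H : Subgroup G)
    (hiso : Nonempty (H ≃* FreeGroup (Fin 2) × K)) (hACEP : AlmostCEP H) :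
    ∀ n : ℕ, 2 ≤ n →
      ∃ M : Subgroup G, IsCEP M ∧ Nonempty (M ≃* FreeGroup (Fin n)) := by
  obtain ⟨S, hfin, h1, hS⟩ := hACEP
  obtain ⟨φ⟩ := hiso
  intro n _
  have : Group.ResiduallyFinite H := Group.ResiduallyFinite.of_injective φ.toMonoidHom φ.injective
  obtain ⟨V, _, _, hVS⟩ := Group.ResiduallyFinite.exists_normal_finiteIndex_disjoint hfin h1
  have : NeZero V.index := ⟨Subgroup.FiniteIndex.index_ne_zero⟩
  let κ : FreeGroup (Fin 2) →* H := φ.symm.toMonoidHom.comp (MonoidHom.inl _ K)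
  let ρ : H →* FreeGroup (Fin 2) := (MonoidHom.fst _ K).comp φ.toMonoidHom
  have hρκ : ρ.comp κ = MonoidHom.id _ := by
    ext
    simp [ρ, κ]
  let ι := κ.comp (cepHom V.index n)
  have hker : ∀ N : Subgroup (FreeGroup (Fin n)), N.Normal →
      ∃ (L : Type) (_ : Group L) (ψ : H →* L), (ψ.comp ι).ker = N := by
    intro N _
    obtain ⟨L, _, ψ, hψ⟩ := exists_ker_comp_cepHom_eq V.index n N
    refine ⟨L, inferInstance, ψ.comp ρ, ?_⟩
    rw [← hψ, MonoidHom.comp_assoc, ← MonoidHom.comp_assoc _ κ ρ, hρκ, MonoidHom.id_comp]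
  have hι : ι.range ≤ V := by
    rw [MonoidHom.range_eq_map, ← FreeGroup.closure_range_of, MonoidHom.map_closure,
      Subgroup.closure_le]
    rintro _ ⟨_, ⟨i, rfl⟩, rfl⟩
    simp only [ι, cepHom, MonoidHom.comp_apply, FreeGroup.lift_apply_of, cepWord]
    rw [map_pow]
    exact V.pow_index_mem _
  have hinj : Function.Injective (H.subtype.comp ι) := by
    refine H.subtype_injective.comp ?_
    obtain ⟨L, _, ψ, hψ⟩ := hker ⊥ inferInstance
    exact Function.Injective.of_comp (f := ψ) ((MonoidHom.ker_eq_bot_iff _).mp hψ)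
  exact ⟨_, isCEP_range_subtype_comp hS V hVS ι hι hker, ⟨(MonoidHom.ofInjective hinj).symm⟩⟩
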